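/- Let V be a finite set of n nodes, each node v carrying a feature vector x_v ∈ ℝ^d and a sensitive value s_v in a finite set 𝒜. For each a ∈ 𝒜 let V_a = {v : s_v = a} and V_{≠a} = V \ V_a, and assume each V_a and V_{≠a} is nonempty. Let Ã ∈ ℝ^{n×n} have nonnegative entries with each row summing to 1, set h_v = Σ_{u∈V} Ã[v,u] x_u, let W ∈ ℝ^{d×c} have spectral norm ‖W‖₂, and set p_v = Wᵀ h_v. Then the demographic parity regularizer L̂_dp = Σ_{a∈𝒜} ‖ (1/|V_a|) Σ_{v∈V_a} p_v − (1/|V_{≠a}|) Σ_{v∈V_{≠a}} p_v ‖₂ satisfies L̂_dp ≤ Σ_{a∈𝒜} ‖W‖₂ · ( |β[a,a] − β[≠a,a]| · ‖μ_a − μ_{≠a}‖₂ + 2√d · δ_a ), where for each a ∈ 𝒜: μ_a and μ_{≠a} are the means of the feature vectors over V_a and V_{≠a}, β[a,a] = (1/|V_a|) Σ_{i∈V_a, j∈V_a} Ã[i,j], β[≠a,a] = (1/|V_{≠a}|) Σ_{i∈V_{≠a}, j∈V_a} Ã[i,j], and δ_a = max( max_{v∈V_a} ‖x_v − μ_a‖_∞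 , max_{v∈V_{≠a}} ‖x_v − μ_{≠a}‖_∞ ). -/

import Mathlib

open Finset

/-- The Euclidean (ℓ²) norm of a vector in ℝ^d. -/
noncomputable def norm2 {d : ℕ} (v : Fin d → ℝ) : ℝ :=
  Real.sqrt (∑ i, v i ^ 2)

/-- The sup (ℓ^∞) norm of a vector in ℝ^d (the `Pi` norm on `Fin d → ℝ`
is the sup norm). -/
noncomputable def normInf {d : ℕ} (v : Fin d → ℝ) : ℝ := ‖v‖

/-- The spectral (operator ℓ²→ℓ²) norm of a matrix `W ∈ ℝ^{d×c}`. -/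
noncomputable def specNorm {d c : ℕ} (W : Matrix (Fin d) (Fin c) ℝ) : ℝ :=
  ‖LinearMap.toContinuousLinearMap (Matrix.toEuclideanLin W)‖

lemma norm2_eq {d : ℕ} (v : Fin d → ℝ) : norm2 v = ‖WithLp.toLp 2 v‖ := by
  simp [norm2, EuclideanSpace.norm_eq]

lemma norm2_add_le {d : ℕ} (v w : Fin d → ℝ) : norm2 (v + w) ≤ norm2 v + norm2 w := by
  simp only [norm2_eq, WithLp.toLp_add]
  exact norm_add_le _ _

lemma norm2_smul {d : ℕ} (r : ℝ) (v : Fin d → ℝ) : norm2 (r • v) = |r| * norm2 v := by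
  simp only [norm2_eq, WithLp.toLp_smul, norm_smul, Real.norm_eq_abs]

lemma norm2_le_sqrt {d : ℕ} (v : Fin d → ℝ) (K : ℝ) (hK : 0 ≤ K) (hv : ∀ i, |v i| ≤ K) :
    norm2 v ≤ Real.sqrt d * K := by
  unfold norm2
  have h1 : ∑ i, v i ^ 2 ≤ d * K ^ 2 := by
    calc ∑ i, v i ^ 2 ≤ ∑ _i : Fin d, K ^ 2 := by
          apply Finset.sum_le_sum
          intro i _
          rw [← sq_abs]
          have := hv i
          gcongr
      _ = d * K ^ 2 := by simp
  calc Real.sqrt (∑ i, v i ^ 2) ≤ Real.sqrt (d * K ^ 2) := Real.sqrt_le_sqrt h1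
    _ = Real.sqrt d * K := by
      rw [Real.sqrt_mul (by positivity), Real.sqrt_sq hK]

lemma norm2_mulVec_le {d c : ℕ} (W : Matrix (Fin d) (Fin c) ℝ) (z : Fin d → ℝ) :
    norm2 ((Matrix.transpose W).mulVec z) ≤ specNorm W * norm2 z := by
  have h1 : specNorm W
      = ‖LinearMap.toContinuousLinearMap (Matrix.toEuclideanLin (Matrix.transpose W))‖ := by
    have h2 := Matrix.toEuclideanLin_conjTranspose_eq_adjoint W
    rw [Matrix.conjTranspose_eq_transpose_of_trivial] at h2
    unfold specNorm
    rw [h2, LinearMap.adjoint_toContinuousLinearMap, LinearIsometryEquiv.norm_map]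
  rw [h1, norm2_eq, norm2_eq]
  exact (LinearMap.toContinuousLinearMap (Matrix.toEuclideanLin (Matrix.transpose W))).le_opNorm
    (WithLp.toLp 2 z)

lemma abs_mean_le {n : ℕ} (S : Finset (Fin n)) (hS : S.Nonempty) (f : Fin n → ℝ) (K : ℝ)
    (hf : ∀ v, |f v| ≤ K) : |(S.card : ℝ)⁻¹ * ∑ v ∈ S, f v| ≤ K := by
  have hc : (0 : ℝ) < S.card := by exact_mod_cast hS.card_pos
  rw [abs_mul, abs_of_pos (inv_pos.mpr hc), inv_mul_le_iff₀ hc]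
  calc |∑ v ∈ S, f v| ≤ ∑ v ∈ S, |f v| := Finset.abs_sum_le_sum_abs _ _
    _ ≤ ∑ _v ∈ S, K := Finset.sum_le_sum fun v _ => hf v
    _ = S.card * K := by simp

/-- Theorem 1 of FairSample: upper bound on the empirical demographic parity
regularizer of a simple GCN in terms of graph structure bias, node attribute bias,
and the model parameters. -/
theorem stmt1 (n d c : ℕ) (x : Fin n → Fin d → ℝ)
    (α : Type) [Fintype α] [DecidableEq α] (s : Fin n → α)
    (V : α → Finset (Fin n)) (hV : ∀ a, V a = Finset.univ.filter fun v => s v = a)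
    (hne : ∀ a, (V a).Nonempty) (hnec : ∀ a, (V a)ᶜ.Nonempty)
    (A : Matrix (Fin n) (Fin n) ℝ)
    (hA0 : ∀ i j, 0 ≤ A i j) (hA1 : ∀ i, ∑ j, A i j = 1)
    (W : Matrix (Fin d) (Fin c) ℝ)
    (h : Fin n → Fin d → ℝ) (hh : ∀ v, h v = ∑ u, A v u • x u)
    (p : Fin n → Fin c → ℝ) (hp : ∀ v, p v = (Matrix.transpose W).mulVec (h v))
    (μ μ' : α → Fin d → ℝ)
    (hμ : ∀ a, μ a = ((V a).card : ℝ)⁻¹ • ∑ v ∈ V a, x v)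
    (hμ' : ∀ a, μ' a = (((V a)ᶜ).card : ℝ)⁻¹ • ∑ v ∈ (V a)ᶜ, x v)
    (β β' : α → ℝ)
    (hβ : ∀ a, β a = ((V a).card : ℝ)⁻¹ * ∑ i ∈ V a, ∑ j ∈ V a, A i j)
    (hβ' : ∀ a, β' a = (((V a)ᶜ).card : ℝ)⁻¹ * ∑ i ∈ (V a)ᶜ, ∑ j ∈ V a, A i j)
    (δ : α → ℝ)
    (hδ : ∀ a, δ a = max ((V a).sup' (hne a) fun v => normInf (x v - μ a))
                         (((V a)ᶜ).sup' (hnec a) fun v => normInf (x v - μ' a))) :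
    ∑ a : α, norm2 (((V a).card : ℝ)⁻¹ • ∑ v ∈ V a, p v
        - (((V a)ᶜ).card : ℝ)⁻¹ • ∑ v ∈ (V a)ᶜ, p v)
      ≤ ∑ a : α, specNorm W
          * (|β a - β' a| * norm2 (μ a - μ' a) + 2 * Real.sqrt d * δ a) := by
  apply Finset.sum_le_sum
  intro a _
  have key : ((V a).card : ℝ)⁻¹ • ∑ v ∈ V a, p v
        - (((V a)ᶜ).card : ℝ)⁻¹ • ∑ v ∈ (V a)ᶜ, p v
      = (Matrix.transpose W).mulVec (((V a).card : ℝ)⁻¹ • ∑ v ∈ V a, h v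
        - (((V a)ᶜ).card : ℝ)⁻¹ • ∑ v ∈ (V a)ᶜ, h v) := by
    simp only [hp, Matrix.mulVec_sub, Matrix.mulVec_smul, Matrix.mulVec_sum]
  rw [key]
  refine (norm2_mulVec_le W _).trans ?_
  refine mul_le_mul_of_nonneg_left ?_ (norm_nonneg _)
  -- the residual of node `u`
  obtain ⟨e, he⟩ : ∃ e : Fin n → Fin d → ℝ,
      ∀ u, e u = x u - (if u ∈ V a then μ a else μ' a) := ⟨_, fun _ => rfl⟩
  have hen : ∀ u, ‖e u‖ ≤ δ a := by
    intro u
    rw [he, hδ]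
    by_cases hu : u ∈ V a
    · rw [if_pos hu]
      exact le_max_of_le_left (Finset.le_sup' (fun v => normInf (x v - μ a)) hu)
    · rw [if_neg hu]
      exact le_max_of_le_right
        (Finset.le_sup' (fun v => normInf (x v - μ' a)) (Finset.mem_compl.mpr hu))
  have hδ0 : 0 ≤ δ a := (norm_nonneg _).trans (hen (hne a).choose)
  obtain ⟨E, hE⟩ : ∃ E : Fin n → Fin d → ℝ, ∀ v i, E v i = ∑ u, A v u * e u i :=
    ⟨fun v i => ∑ u, A v u * e u i, fun _ _ => rfl⟩
  have hEn : ∀ v i, |E v i| ≤ δ a := by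
    intro v i
    rw [hE]
    calc |∑ u, A v u * e u i| ≤ ∑ u, |A v u * e u i| := Finset.abs_sum_le_sum_abs _ _
      _ ≤ ∑ u, A v u * δ a := by
        apply Finset.sum_le_sum
        intro u _
        rw [abs_mul, abs_of_nonneg (hA0 v u)]
        exact mul_le_mul_of_nonneg_left ((norm_le_pi_norm (e u) i).trans (hen u)) (hA0 v u)
      _ = δ a := by rw [← Finset.sum_mul, hA1, one_mul]
  have hdec : ∀ v i, h v i = E v i + (μ' a i + (∑ u ∈ V a, A v u) * (μ a i - μ' a i)) := by
    intro v i
    have h3 : ∀ u, A v u * x u i = A v u * e u i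
        + (A v u * μ' a i + (if u ∈ V a then A v u else 0) * (μ a i - μ' a i)) := by
      intro u
      rw [he]
      by_cases hu : u ∈ V a
      · simp only [if_pos hu, Pi.sub_apply]; ring
      · simp only [if_neg hu, Pi.sub_apply]; ring
    rw [hh, hE, Finset.sum_apply]
    simp only [Pi.smul_apply, smul_eq_mul]
    rw [Finset.sum_congr rfl fun u _ => h3 u, Finset.sum_add_distrib, Finset.sum_add_distrib,
      ← Finset.sum_mul, ← Finset.sum_mul, hA1, one_mul]
    simp
  have hmean : ∀ (S : Finset (Fin n)), S.Nonempty → ∀ i, (S.card : ℝ)⁻¹ * ∑ v ∈ S, h v i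
      = (S.card : ℝ)⁻¹ * ∑ v ∈ S, E v i + (μ' a i
        + ((S.card : ℝ)⁻¹ * ∑ v ∈ S, ∑ u ∈ V a, A v u) * (μ a i - μ' a i)) := by
    intro S hS i
    have hc : (S.card : ℝ) ≠ 0 := by exact_mod_cast hS.card_pos.ne'
    simp only [hdec, Finset.sum_add_distrib, ← Finset.sum_mul, Finset.sum_const, nsmul_eq_mul]
    field_simp
  obtain ⟨R, hR⟩ : ∃ R : Fin d → ℝ, ∀ i, R i = ((V a).card : ℝ)⁻¹ * ∑ v ∈ V a, E v i
      - (((V a)ᶜ).card : ℝ)⁻¹ * ∑ v ∈ (V a)ᶜ, E v i := ⟨fun i => _, fun _ => rfl⟩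
  have hRn : ∀ i, |R i| ≤ 2 * δ a := by
    intro i
    rw [hR]
    have h1 := abs_mean_le (V a) (hne a) (fun v => E v i) (δ a) (fun v => hEn v i)
    have h2 := abs_mean_le (V a)ᶜ (hnec a) (fun v => E v i) (δ a) (fun v => hEn v i)
    refine (abs_sub _ _).trans ?_
    linarith
  have hD : ((V a).card : ℝ)⁻¹ • ∑ v ∈ V a, h v - (((V a)ᶜ).card : ℝ)⁻¹ • ∑ v ∈ (V a)ᶜ, h v
      = (β a - β' a) • (μ a - μ' a) + R := by
    funext i
    simp only [Pi.sub_apply, Pi.add_apply, Pi.smul_apply, Finset.sum_apply, smul_eq_mul]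
    rw [hmean _ (hne a), hmean _ (hnec a), ← hβ, ← hβ', hR]
    ring
  rw [hD]
  refine (norm2_add_le _ _).trans ?_
  rw [norm2_smul]
  have := norm2_le_sqrt R (2 * δ a) (by linarith) hRn
  linarith
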